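/- Suppose p satisfies Z ⊥ C | A, and let θ' and φ_fdtd be as defined in the context. Then Var_p(φ_fdtd) = Σ_z (p(z|a⋆) − p(z|a°))²·Σ_{ā,c} p(ā,c)·var(Y|ā,z,c)/p(z|ā) + Σ_z p(z|a⋆)·(Σ_{ā,c} E(Y|ā,z,c)·p(ā|c)·p(c))²/p(a⋆) − (Σ_{ā,z,c} E(Y|ā,z,c)·p(z|a⋆)·p(ā|c)·p(c))²/p(a⋆) + Σ_z p(z|a°)·(Σ_{ā,c} E(Y|ā,z,c)·p(ā|c)·p(c))²/p(a°) − (Σ_{ā,z,c} E(Y|ā,z,c)·p(z|a°)·p(ā|c)·p(c))²/p(a°) + Σ_{ā,c} p(ā,c)·(Σ_z E(Y|ā,z,c)·(p(z|a⋆) − p(z|a°)))² − θ'². -/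

import Mathlib

open Finset

noncomputable section

namespace TwoDoorPaper

/-- Indicator 1[a = b] as a real number. -/
def ind {A : Type*} [DecidableEq A] (a b : A) : ℝ := if a = b then 1 else 0

variable {C A Z Y : Type*} [Fintype C] [Fintype A] [Fintype Z] [Fintype Y]

/-- Marginal p(c). -/
def pC (p : C → A → Z → Y → ℝ) (c : C) : ℝ := ∑ a, ∑ z, ∑ y, p c a z y

/-- Marginal p(a,c). -/
def pAC (p : C → A → Z → Y → ℝ) (a : A) (c : C) : ℝ := ∑ z, ∑ y, p c a z y

/-- Marginal p(c,a,z). -/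
def pCAZ (p : C → A → Z → Y → ℝ) (c : C) (a : A) (z : Z) : ℝ := ∑ y, p c a z y

/-- Marginal p(a). -/
def pA (p : C → A → Z → Y → ℝ) (a : A) : ℝ := ∑ c, pAC p a c

/-- Marginal p(a,z). -/
def pAZ (p : C → A → Z → Y → ℝ) (a : A) (z : Z) : ℝ := ∑ c, pCAZ p c a z

/-- Marginal p(z,c). -/
def pZC (p : C → A → Z → Y → ℝ) (z : Z) (c : C) : ℝ := ∑ a, pCAZ p c a z

/-- Conditional p(a|c). -/
def cA (p : C → A → Z → Y → ℝ) (a : A) (c : C) : ℝ := pAC p a c / pC p c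

/-- Conditional p(z|a,c). -/
def cZ (p : C → A → Z → Y → ℝ) (z : Z) (a : A) (c : C) : ℝ := pCAZ p c a z / pAC p a c

/-- Conditional p(z|a). -/
def cZA (p : C → A → Z → Y → ℝ) (z : Z) (a : A) : ℝ := pAZ p a z / pA p a

/-- Conditional p(y|a,z,c). -/
def cY (p : C → A → Z → Y → ℝ) (a : A) (z : Z) (c : C) (y : Y) : ℝ := p c a z y / pCAZ p c a z

/-- Conditional p(y|a,z). -/
def cYaz (p : C → A → Z → Y → ℝ) (a : A) (z : Z) (y : Y) : ℝ := (∑ c, p c a z y) / pAZ p a z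

/-- Conditional p(y|a,c). -/
def cYac (p : C → A → Z → Y → ℝ) (a : A) (c : C) (y : Y) : ℝ := (∑ z, p c a z y) / pAC p a c

/-- Conditional p(y|z,c). -/
def cYzc (p : C → A → Z → Y → ℝ) (z : Z) (c : C) (y : Y) : ℝ := (∑ a, p c a z y) / pZC p z c

/-- Conditional expectation E(Y|a,z,c). -/
def EYazc (p : C → A → Z → Y → ℝ) (yv : Y → ℝ) (a : A) (z : Z) (c : C) : ℝ :=
  ∑ y, yv y * cY p a z c y

/-- Conditional variance var(Y|a,z,c). -/
def VYazc (p : C → A → Z → Y → ℝ) (yv : Y → ℝ) (a : A) (z : Z) (c : C) : ℝ :=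
  (∑ y, (yv y) ^ 2 * cY p a z c y) - (EYazc p yv a z c) ^ 2

/-- Conditional expectation E(Y|a,z). -/
def EYaz (p : C → A → Z → Y → ℝ) (yv : Y → ℝ) (a : A) (z : Z) : ℝ :=
  ∑ y, yv y * cYaz p a z y

/-- Conditional variance var(Y|a,z). -/
def VYaz (p : C → A → Z → Y → ℝ) (yv : Y → ℝ) (a : A) (z : Z) : ℝ :=
  (∑ y, (yv y) ^ 2 * cYaz p a z y) - (EYaz p yv a z) ^ 2

/-- Conditional expectation E(Y|a,c). -/
def EYac (p : C → A → Z → Y → ℝ) (yv : Y → ℝ) (a : A) (c : C) : ℝ :=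
  ∑ y, yv y * cYac p a c y

/-- Conditional expectation E(Y|z,c). -/
def EYzc (p : C → A → Z → Y → ℝ) (yv : Y → ℝ) (z : Z) (c : C) : ℝ :=
  ∑ y, yv y * cYzc p z c y

/-- Conditional variance var(Y|z,c). -/
def VYzc (p : C → A → Z → Y → ℝ) (yv : Y → ℝ) (z : Z) (c : C) : ℝ :=
  (∑ y, (yv y) ^ 2 * cYzc p z c y) - (EYzc p yv z c) ^ 2

/-- var(C|a) for real-valued covariates. -/
def VCgivenA (p : C → A → Z → Y → ℝ) (cv : C → ℝ) (a : A) : ℝ :=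
  (∑ c, (cv c) ^ 2 * (pAC p a c / pA p a)) - (∑ c, cv c * (pAC p a c / pA p a)) ^ 2

/-- var(Z|a) for real-valued mediators. -/
def VZgivenA (p : C → A → Z → Y → ℝ) (zv : Z → ℝ) (a : A) : ℝ :=
  (∑ z, (zv z) ^ 2 * cZA p z a) - (∑ z, zv z * cZA p z a) ^ 2

/-- Expectation of f under p. -/
def Ep (p : C → A → Z → Y → ℝ) (f : C → A → Z → Y → ℝ) : ℝ :=
  ∑ c, ∑ a, ∑ z, ∑ y, p c a z y * f c a z y

/-- Variance of f under p. -/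
def Varp (p : C → A → Z → Y → ℝ) (f : C → A → Z → Y → ℝ) : ℝ :=
  (∑ c, ∑ a, ∑ z, ∑ y, p c a z y * (f c a z y) ^ 2) - (Ep p f) ^ 2

/-- p is a strictly positive probability mass function. -/
def IsPMF (p : C → A → Z → Y → ℝ) : Prop :=
  (∀ c a z y, 0 < p c a z y) ∧ (∑ c, ∑ a, ∑ z, ∑ y, p c a z y) = 1

/-- Y ⊥ A | (Z, C): p(y|a,z,c) does not depend on a. -/
def IndepYA (p : C → A → Z → Y → ℝ) : Prop :=
  ∀ a a' z c y, cY p a z c y = cY p a' z c y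

/-- Z ⊥ C | A: p(z|a,c) = p(z|a) for all c. -/
def IndepZC (p : C → A → Z → Y → ℝ) : Prop :=
  ∀ z a c, cZ p z a c = cZA p z a

/-- θ_td. -/
def thTD (p : C → A → Z → Y → ℝ) (yv : Y → ℝ) (astar acirc : A) : ℝ :=
  ∑ z, ∑ c, ∑ ab, EYazc p yv ab z c * (cZ p z astar c - cZ p z acirc c) * cA p ab c * pC p c

/-- The two-door efficient influence function φ_td. -/
def phiTD [DecidableEq A] (p : C → A → Z → Y → ℝ) (yv : Y → ℝ) (astar acirc : A)
    (c : C) (a : A) (z : Z) (y : Y) : ℝ :=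
  (yv y - EYazc p yv a z c) * (cZ p z astar c - cZ p z acirc c) / cZ p z a c
  + ((∑ ab, EYazc p yv ab z c * cA p ab c)
      - ∑ ab, ∑ z', EYazc p yv ab z' c * cZ p z' a c * cA p ab c)
    * (ind a astar - ind a acirc) / cA p a c
  + (∑ z', EYazc p yv a z' c * (cZ p z' astar c - cZ p z' acirc c))
  - thTD p yv astar acirc

/-- θ_bd. -/
def thBD (p : C → A → Z → Y → ℝ) (yv : Y → ℝ) (astar acirc : A) : ℝ :=
  ∑ c, pC p c * (EYac p yv astar c - EYac p yv acirc c)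

/-- The back-door efficient influence function φ_bd. -/
def phiBD [DecidableEq A] (p : C → A → Z → Y → ℝ) (yv : Y → ℝ) (astar acirc : A)
    (c : C) (a : A) (_z : Z) (y : Y) : ℝ :=
  ind a astar * (yv y - EYac p yv astar c) / cA p astar c
  - ind a acirc * (yv y - EYac p yv acirc c) / cA p acirc c
  + EYac p yv astar c - EYac p yv acirc c - thBD p yv astar acirc

/-- θ° (for the combined back-door/two-door model). -/
def thBDTD (p : C → A → Z → Y → ℝ) (yv : Y → ℝ) (astar acirc : A) : ℝ :=
  ∑ z, ∑ c, EYzc p yv z c * (cZ p z astar c - cZ p z acirc c) * pC p c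

/-- The efficient influence function φ_bdtd. -/
def phiBDTD [DecidableEq A] (p : C → A → Z → Y → ℝ) (yv : Y → ℝ) (astar acirc : A)
    (c : C) (a : A) (z : Z) (y : Y) : ℝ :=
  (yv y - EYzc p yv z c) * (cZ p z astar c - cZ p z acirc c) / (∑ ab, cZ p z ab c * cA p ab c)
  + (EYzc p yv z c - ∑ z', EYzc p yv z' c * cZ p z' a c)
    * (ind a astar - ind a acirc) / cA p a c
  + (∑ z', EYzc p yv z' c * (cZ p z' astar c - cZ p z' acirc c))
  - thBDTD p yv astar acirc

/-- ψ_fd(ă). -/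
def psiFD (p : C → A → Z → Y → ℝ) (yv : Y → ℝ) (abreve : A) : ℝ :=
  ∑ z, ∑ ab, EYaz p yv ab z * pA p ab * cZA p z abreve

/-- θ_fd. -/
def thFD (p : C → A → Z → Y → ℝ) (yv : Y → ℝ) (astar acirc : A) : ℝ :=
  psiFD p yv astar - psiFD p yv acirc

/-- The front-door efficient influence function φ_fd. -/
def phiFD [DecidableEq A] (p : C → A → Z → Y → ℝ) (yv : Y → ℝ) (astar acirc : A)
    (_c : C) (a : A) (z : Z) (y : Y) : ℝ :=
  (yv y - EYaz p yv a z) * (cZA p z astar - cZA p z acirc) / cZA p z a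
  + ind a astar * ((∑ ab, EYaz p yv ab z * pA p ab) - psiFD p yv astar) / pA p astar
  - ind a acirc * ((∑ ab, EYaz p yv ab z * pA p ab) - psiFD p yv acirc) / pA p acirc
  + (∑ z', EYaz p yv a z' * (cZA p z' astar - cZA p z' acirc))
  - thFD p yv astar acirc

/-- θ' (for the combined front-door/two-door model). -/
def thFDTD (p : C → A → Z → Y → ℝ) (yv : Y → ℝ) (astar acirc : A) : ℝ :=
  ∑ c, ∑ ab, ∑ z, EYazc p yv ab z c * (cZA p z astar - cZA p z acirc) * cA p ab c * pC p c

/-- The efficient influence function φ_fdtd. -/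
def phiFDTD [DecidableEq A] (p : C → A → Z → Y → ℝ) (yv : Y → ℝ) (astar acirc : A)
    (c : C) (a : A) (z : Z) (y : Y) : ℝ :=
  (yv y - EYazc p yv a z c) * (cZA p z astar - cZA p z acirc) / cZA p z a
  + (∑ c', ((∑ ab, EYazc p yv ab z c' * cA p ab c')
        - ∑ ab, ∑ z', EYazc p yv ab z' c' * cZA p z' a * cA p ab c') * pC p c')
    * (ind a astar - ind a acirc) / pA p a
  + (∑ z', EYazc p yv a z' c * (cZA p z' astar - cZA p z' acirc))
  - thFDTD p yv astar acirc

/-- θ'' (for the combined back/front/two-door model). -/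
def thBDFDTD (p : C → A → Z → Y → ℝ) (yv : Y → ℝ) (astar acirc : A) : ℝ :=
  ∑ c, ∑ z, EYzc p yv z c * (cZA p z astar - cZA p z acirc) * pC p c

/-- The efficient influence function φ_bdfdtd. -/
def phiBDFDTD [DecidableEq A] (p : C → A → Z → Y → ℝ) (yv : Y → ℝ) (astar acirc : A)
    (c : C) (a : A) (z : Z) (y : Y) : ℝ :=
  (yv y - EYzc p yv z c) * (cZA p z astar - cZA p z acirc) / (∑ ab, cA p ab c * cZA p z ab)
  + (∑ c', (EYzc p yv z c' - ∑ z', EYzc p yv z' c' * cZA p z' a) * pC p c')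
    * (ind a astar - ind a acirc) / (∑ c', pC p c' * cA p a c')
  + (∑ z', EYzc p yv z' c * (cZA p z' astar - cZA p z' acirc))
  - thBDFDTD p yv astar acirc

section Helpers

theorem sum_mul_affine {Y : Type*} [Fintype Y] (f v : Y → ℝ) (q e w b : ℝ)
    (h0 : ∑ y, f y = q) (h1 : ∑ y, f y * v y = q * e) :
    ∑ y, f y * ((v y - e) * w + b) = q * b := by
  have h : ∀ y, f y * ((v y - e) * w + b) = w * (f y * v y) + (b - e * w) * f y :=
    fun y => by ring
  simp only [h, sum_add_distrib, ← mul_sum, h0, h1]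
  ring

theorem sum_mul_affine_sq {Y : Type*} [Fintype Y] (f v : Y → ℝ) (q e V w b : ℝ)
    (h0 : ∑ y, f y = q) (h1 : ∑ y, f y * v y = q * e)
    (h2 : ∑ y, f y * v y ^ 2 = q * (V + e ^ 2)) :
    ∑ y, f y * ((v y - e) * w + b) ^ 2 = q * (V * w ^ 2 + b ^ 2) := by
  have h : ∀ y, f y * ((v y - e) * w + b) ^ 2
      = w ^ 2 * (f y * v y ^ 2) + 2 * w * (b - e * w) * (f y * v y)
        + (b - e * w) ^ 2 * f y := fun y => by ring
  simp only [h, sum_add_distrib, ← mul_sum, h0, h1, h2]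
  ring

theorem sum_mul_centered {Z : Type*} [Fintype Z] (k H : Z → ℝ) (s b : ℝ) (hk : ∑ z, k z = 1) :
    ∑ z, k z * ((H z - ∑ z', H z' * k z') * s + b) = b := by
  rw [sum_mul_affine k H 1 (∑ z', H z' * k z') s b hk (by simp [mul_comm])]
  ring

theorem sum_mul_centered_sq {Z : Type*} [Fintype Z] (k H : Z → ℝ) (s b : ℝ)
    (hk : ∑ z, k z = 1) :
    ∑ z, k z * ((H z - ∑ z', H z' * k z') * s + b) ^ 2
      = s ^ 2 * (∑ z, k z * H z ^ 2 - (∑ z, H z * k z) ^ 2) + b ^ 2 := by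
  rw [sum_mul_affine_sq k H 1 (∑ z', H z' * k z')
    (∑ z, k z * H z ^ 2 - (∑ z, H z * k z) ^ 2) s b hk (by simp [mul_comm]) (by ring)]
  ring

theorem sum_indicator_contrast_sq [DecidableEq A] (P G : A → ℝ) {astar acirc : A}
    (hne : astar ≠ acirc) (hP : ∀ a, P a ≠ 0) :
    ∑ a, P a * (((ind a astar - ind a acirc) / P a) ^ 2 * G a)
      = G astar / P astar + G acirc / P acirc := by
  have h : ∀ a, P a * (((ind a astar - ind a acirc) / P a) ^ 2 * G a)
      = (if a = astar then G a / P a else 0) + (if a = acirc then G a / P a else 0) := by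
    intro a
    have := hP a
    unfold ind
    by_cases h1 : a = astar
    · subst h1
      simp only [if_true, if_neg hne]
      field_simp
      ring
    · by_cases h2 : a = acirc
      · subst h2
        simp only [if_true, if_neg h1]
        field_simp
        ring
      · simp [h1, h2]
  simp only [h, sum_add_distrib, sum_ite_eq', mem_univ, if_true]

variable {p : C → A → Z → Y → ℝ}

theorem IsPMF.pCAZ_pos [Nonempty Y] (hp : IsPMF p) (c : C) (a : A) (z : Z) :
    0 < pCAZ p c a z :=
  sum_pos (fun y _ => hp.1 c a z y) univ_nonempty

theorem IsPMF.pAC_pos [Nonempty Z] [Nonempty Y] (hp : IsPMF p) (a : A) (c : C) :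
    0 < pAC p a c :=
  sum_pos (fun z _ => hp.pCAZ_pos c a z) univ_nonempty

theorem IsPMF.pC_pos [Nonempty A] [Nonempty Z] [Nonempty Y] (hp : IsPMF p) (c : C) :
    0 < pC p c :=
  sum_pos (fun a _ => hp.pAC_pos a c) univ_nonempty

theorem IsPMF.pA_pos [Nonempty C] [Nonempty Z] [Nonempty Y] (hp : IsPMF p) (a : A) :
    0 < pA p a :=
  sum_pos (fun c _ => hp.pAC_pos a c) univ_nonempty

theorem IsPMF.pAZ_pos [Nonempty C] [Nonempty Y] (hp : IsPMF p) (a : A) (z : Z) :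
    0 < pAZ p a z :=
  sum_pos (fun c _ => hp.pCAZ_pos c a z) univ_nonempty

theorem IsPMF.cZA_pos [Nonempty C] [Nonempty Z] [Nonempty Y] (hp : IsPMF p) (z : Z) (a : A) :
    0 < cZA p z a :=
  div_pos (hp.pAZ_pos a z) (hp.pA_pos a)

theorem IsPMF.cA_mul_pC [Nonempty A] [Nonempty Z] [Nonempty Y] (hp : IsPMF p) (a : A) (c : C) :
    cA p a c * pC p c = pAC p a c :=
  div_mul_cancel₀ _ (hp.pC_pos c).ne'

theorem IsPMF.sum_cZA [Nonempty C] [Nonempty Z] [Nonempty Y] (hp : IsPMF p) (a : A) :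
    ∑ z, cZA p z a = 1 := by
  have h : ∑ z, pAZ p a z = pA p a := sum_comm
  simp only [cZA, ← sum_div, h]
  exact div_self (hp.pA_pos a).ne'

theorem IsPMF.pCAZ_eq [Nonempty Z] [Nonempty Y] (hp : IsPMF p) (hzc : IndepZC p)
    (c : C) (a : A) (z : Z) : pCAZ p c a z = pAC p a c * cZA p z a := by
  rw [← hzc z a c, cZ, mul_div_cancel₀ _ (hp.pAC_pos a c).ne']

theorem IsPMF.sum_mul_eq [Nonempty Y] (hp : IsPMF p) (g : Y → ℝ) (a : A) (z : Z) (c : C) :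
    ∑ y, p c a z y * g y = pCAZ p c a z * ∑ y, g y * cY p a z c y := by
  rw [mul_sum]
  refine sum_congr rfl fun y _ => ?_
  have := (hp.pCAZ_pos c a z).ne'
  simp only [cY]
  field_simp

theorem IsPMF.sum_mul_outcome [Nonempty Y] (hp : IsPMF p) (yv : Y → ℝ) (a : A) (z : Z) (c : C) :
    ∑ y, p c a z y * yv y = pCAZ p c a z * EYazc p yv a z c :=
  hp.sum_mul_eq yv a z c

/-- The standardized regression `∑ E(Y|ā,z,c) p(ā,c)` as a function of `z`. -/
def stdReg (p : C → A → Z → Y → ℝ) (yv : Y → ℝ) (z : Z) : ℝ :=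
  ∑ a, ∑ c, EYazc p yv a z c * pAC p a c

/-- The contrast `∑_z E(Y|a,z,c) (p(z|a⋆) - p(z|a°))`. -/
def medContrast (p : C → A → Z → Y → ℝ) (yv : Y → ℝ) (astar acirc a : A) (c : C) : ℝ :=
  ∑ z, EYazc p yv a z c * (cZA p z astar - cZA p z acirc)

theorem IsPMF.sum_stdReg [Nonempty A] [Nonempty Z] [Nonempty Y] (hp : IsPMF p) (yv : Y → ℝ)
    (a : A) : ∑ ab, ∑ z, ∑ c, EYazc p yv ab z c * cZA p z a * cA p ab c * pC p c
      = ∑ z, stdReg p yv z * cZA p z a := by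
  rw [sum_comm]
  simp only [stdReg, sum_mul]
  refine sum_congr rfl fun z _ => sum_congr rfl fun b _ => sum_congr rfl fun c _ => ?_
  rw [← hp.cA_mul_pC b c]
  ring

theorem IsPMF.sum_stdReg_residual [Nonempty A] [Nonempty Z] [Nonempty Y] (hp : IsPMF p)
    (yv : Y → ℝ) (a : A) (z : Z) :
    (∑ c, ((∑ ab, EYazc p yv ab z c * cA p ab c)
        - ∑ ab, ∑ z', EYazc p yv ab z' c * cZA p z' a * cA p ab c) * pC p c)
      = stdReg p yv z - ∑ z', stdReg p yv z' * cZA p z' a := by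
  simp only [sub_mul, sum_sub_distrib]
  congr 1
  · simp only [sum_mul, stdReg]
    rw [sum_comm]
    simp only [mul_assoc, hp.cA_mul_pC]
  · rw [← hp.sum_stdReg]
    simp only [sum_mul]
    rw [sum_comm]
    exact sum_congr rfl fun b _ => sum_comm

theorem IsPMF.thFDTD_eq [Nonempty A] [Nonempty Z] [Nonempty Y] (hp : IsPMF p) (yv : Y → ℝ)
    (astar acirc : A) : thFDTD p yv astar acirc
      = ∑ c, ∑ a, pAC p a c * medContrast p yv astar acirc a c := by
  simp only [thFDTD, medContrast, mul_sum]
  refine sum_congr rfl fun c _ => sum_congr rfl fun a _ => sum_congr rfl fun z _ => ?_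
  rw [← hp.cA_mul_pC a c]
  ring

theorem IsPMF.sum_pAC (hp : IsPMF p) : ∑ c, ∑ a, pAC p a c = 1 := hp.2

theorem IsPMF.phiFDTD_eq [Nonempty A] [Nonempty Z] [Nonempty Y] [DecidableEq A] (hp : IsPMF p)
    (yv : Y → ℝ) (astar acirc : A) (c : C) (a : A) (z : Z) (y : Y) :
    phiFDTD p yv astar acirc c a z y
      = (yv y - EYazc p yv a z c) * ((cZA p z astar - cZA p z acirc) / cZA p z a)
        + ((stdReg p yv z - ∑ z', stdReg p yv z' * cZA p z' a)
            * ((ind a astar - ind a acirc) / pA p a)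
          + (medContrast p yv astar acirc a c - thFDTD p yv astar acirc)) := by
  simp only [phiFDTD, hp.sum_stdReg_residual, medContrast]
  ring

theorem IsPMF.Ep_phiFDTD [Nonempty C] [Nonempty A] [Nonempty Z] [Nonempty Y] [DecidableEq A]
    (hp : IsPMF p) (hzc : IndepZC p) (yv : Y → ℝ) (astar acirc : A) :
    Ep p (phiFDTD p yv astar acirc) = 0 := by
  have h : ∀ c a, ∑ z, ∑ y, p c a z y * phiFDTD p yv astar acirc c a z y
      = pAC p a c * (medContrast p yv astar acirc a c - thFDTD p yv astar acirc) := by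
    intro c a
    simp only [hp.phiFDTD_eq]
    refine Eq.trans ?_ (congrArg (pAC p a c * ·)
      (sum_mul_centered (fun z => cZA p z a) (stdReg p yv)
        ((ind a astar - ind a acirc) / pA p a) _ (hp.sum_cZA a)))
    simp only [mul_sum]
    refine sum_congr rfl fun z _ => ?_
    rw [sum_mul_affine _ yv _ _ _ _ rfl (hp.sum_mul_outcome yv a z c), ← mul_assoc,
      ← hp.pCAZ_eq hzc]
    rfl
  simp only [Ep, h, mul_sub, sum_sub_distrib, ← sum_mul, hp.sum_pAC]
  rw [← hp.thFDTD_eq]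
  ring

theorem IsPMF.sum_phiFDTD_sq [Nonempty C] [Nonempty A] [Nonempty Z] [Nonempty Y]
    [DecidableEq A] (hp : IsPMF p) (hzc : IndepZC p) (yv : Y → ℝ) (astar acirc : A)
    (c : C) (a : A) :
    ∑ z, ∑ y, p c a z y * phiFDTD p yv astar acirc c a z y ^ 2
      = (∑ z, (cZA p z astar - cZA p z acirc) ^ 2
            * (pAC p a c * VYazc p yv a z c / cZA p z a))
        + pAC p a c * (((ind a astar - ind a acirc) / pA p a) ^ 2
            * (∑ z, cZA p z a * stdReg p yv z ^ 2 - (∑ z, stdReg p yv z * cZA p z a) ^ 2))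
        + pAC p a c
            * (medContrast p yv astar acirc a c - thFDTD p yv astar acirc) ^ 2 := by
  simp only [hp.phiFDTD_eq]
  rw [add_assoc, ← mul_add, ← sum_mul_centered_sq (fun z => cZA p z a) (stdReg p yv) _ _
    (hp.sum_cZA a), mul_sum, ← sum_add_distrib]
  refine sum_congr rfl fun z _ => ?_
  have hV : ∑ y, p c a z y * yv y ^ 2
      = pCAZ p c a z * (VYazc p yv a z c + EYazc p yv a z c ^ 2) := by
    rw [hp.sum_mul_eq (fun y => yv y ^ 2) a z c, VYazc, sub_add_cancel]
  rw [sum_mul_affine_sq _ yv _ _ _ _ _ rfl (hp.sum_mul_outcome yv a z c) hV]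
  change pCAZ p c a z * _ = _
  rw [hp.pCAZ_eq hzc]
  have := (hp.cZA_pos z a).ne'
  field_simp

end Helpers

/-- Proposition 7 (efficiency bound under the combined front-door/two-door model). -/
theorem stmt14
    {C A Z Y : Type*} [Fintype C] [Fintype A] [Fintype Z] [Fintype Y]
    [Nonempty C] [Nonempty A] [Nonempty Z] [Nonempty Y] [DecidableEq A]
    (p : C → A → Z → Y → ℝ) (yv : Y → ℝ) (hyv : Function.Injective yv)
    (hp : IsPMF p) (astar acirc : A) (hne : astar ≠ acirc)
    (hzc : IndepZC p) :
    Varp p (phiFDTD p yv astar acirc) =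
      (∑ z, (cZA p z astar - cZA p z acirc) ^ 2
          * ∑ ab, ∑ c, pAC p ab c * VYazc p yv ab z c / cZA p z ab)
      + (∑ z, cZA p z astar * (∑ ab, ∑ c, EYazc p yv ab z c * cA p ab c * pC p c) ^ 2)
          / pA p astar
      - (∑ ab, ∑ z, ∑ c, EYazc p yv ab z c * cZA p z astar * cA p ab c * pC p c) ^ 2
          / pA p astar
      + (∑ z, cZA p z acirc * (∑ ab, ∑ c, EYazc p yv ab z c * cA p ab c * pC p c) ^ 2)
          / pA p acirc
      - (∑ ab, ∑ z, ∑ c, EYazc p yv ab z c * cZA p z acirc * cA p ab c * pC p c) ^ 2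
          / pA p acirc
      + (∑ ab, ∑ c, pAC p ab c
            * (∑ z, EYazc p yv ab z c * (cZA p z astar - cZA p z acirc)) ^ 2)
      - (thFDTD p yv astar acirc) ^ 2 := by
  have hH : ∀ z, ∑ ab, ∑ c, EYazc p yv ab z c * cA p ab c * pC p c = stdReg p yv z := by
    intro z
    simp only [stdReg, mul_assoc, hp.cA_mul_pC]
  rw [Varp, hp.Ep_phiFDTD hzc]
  simp only [hp.sum_phiFDTD_sq hzc, sum_add_distrib, hH, hp.sum_stdReg]
  have hresidual : ∑ c, ∑ a, ∑ z, (cZA p z astar - cZA p z acirc) ^ 2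
        * (pAC p a c * VYazc p yv a z c / cZA p z a)
      = ∑ z, (cZA p z astar - cZA p z acirc) ^ 2
          * ∑ a, ∑ c, pAC p a c * VYazc p yv a z c / cZA p z a := by
    simp only [mul_sum]
    rw [sum_comm, sum_comm (t := (univ : Finset A))]
    exact sum_congr rfl fun a _ => sum_comm
  have hmediator := sum_indicator_contrast_sq (pA p)
    (fun a => ∑ z, cZA p z a * stdReg p yv z ^ 2 - (∑ z, stdReg p yv z * cZA p z a) ^ 2)
    hne (fun a => (hp.pA_pos a).ne')
  have hcovariate : ∑ c, ∑ a, pAC p a c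
        * (medContrast p yv astar acirc a c - thFDTD p yv astar acirc) ^ 2
      = (∑ a, ∑ c, pAC p a c * medContrast p yv astar acirc a c ^ 2)
        - thFDTD p yv astar acirc ^ 2 := by
    rw [sum_comm (s := (univ : Finset A))]
    have h : ∀ c a, pAC p a c
          * (medContrast p yv astar acirc a c - thFDTD p yv astar acirc) ^ 2
        = pAC p a c * medContrast p yv astar acirc a c ^ 2
          - (pAC p a c * medContrast p yv astar acirc a c) * (2 * thFDTD p yv astar acirc)
          + pAC p a c * thFDTD p yv astar acirc ^ 2 := fun c a => by ring
    simp only [h, sum_add_distrib, sum_sub_distrib, ← sum_mul, hp.sum_pAC, ← hp.thFDTD_eq]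
    ring
  rw [hresidual, hcovariate, sum_comm (t := (univ : Finset A))]
  simp only [← sum_mul]
  change _ + ∑ a, pA p a * _ + _ - _ = _
  rw [hmediator]
  simp only [medContrast]
  ring


end TwoDoorPaper
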